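/- Let X₁, X₂ ⊆ Z ⊆ M.E. If X₁ is closed in Z and X₂ is closed in Z, then X₁ ∩ X₂ is closed in Z. -/

import Mathlib

open Set

/-- The relative rank `relRank(X, X ∪ A)` of a finite set `A` over a set `X`: the least
cardinality of a subset `A₀` of `A` with `A ⊆ closure (X ∪ A₀)`. -/
noncomputable def mRelRk {V : Type*} (M : Matroid V) (X A : Set V) : ℕ :=
  sInf {n : ℕ | ∃ A₀ : Set V, A₀ ⊆ A ∧ A₀.ncard = n ∧ A ⊆ M.closure (X ∪ A₀)}

/-- The relative predimension `δ(A/X) = relRank(X, X ∪ A) - α·|(A ∩ P) \ X|` of a finite set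
`A` over a set `X`, where `P` is the set of colored elements. -/
noncomputable def mDeltaRel {V : Type*} (M : Matroid V) (P : Set V) (α : ℝ)
    (A X : Set V) : ℝ :=
  (mRelRk M X A : ℝ) - α * (((A ∩ P) \ X).ncard : ℝ)

/-- `X` is closed (self-sufficient) in `Y`, written `X ≤ Y`: `X ⊆ Y` and `δ(A/X) ≥ 0` for
every finite `A ⊆ Y`. -/
def SelfSuffIn {V : Type*} (M : Matroid V) (P : Set V) (α : ℝ) (X Y : Set V) : Prop :=
  X ⊆ Y ∧ ∀ A : Set V, A ⊆ Y → A.Finite → 0 ≤ mDeltaRel M P α A X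

/-- A subset `A₀` of `A` spanning `A` over `X` bounds the relative rank. -/
theorem mRelRk_le_ncard {V : Type*} {M : Matroid V} {X A A₀ : Set V} (hA₀ : A₀ ⊆ A)
    (h : A ⊆ M.closure (X ∪ A₀)) : mRelRk M X A ≤ A₀.ncard :=
  Nat.sInf_le ⟨A₀, hA₀, rfl, h⟩

/-- The relative rank is attained. -/
theorem exists_ncard_eq_mRelRk {V : Type*} {M : Matroid V} {X A : Set V} (hX : X ⊆ M.E)
    (hA : A ⊆ M.E) : ∃ A₀ ⊆ A, A₀.ncard = mRelRk M X A ∧ A ⊆ M.closure (X ∪ A₀) := by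
  refine Nat.sInf_mem (s := {n : ℕ | ∃ A₀ : Set V, A₀ ⊆ A ∧ A₀.ncard = n ∧
    A ⊆ M.closure (X ∪ A₀)}) ⟨A.ncard, A, Subset.rfl, rfl, ?_⟩
  exact subset_union_right.trans (M.subset_closure _ (union_subset hX hA))

/-- A basis of `A` in the contraction by `X` spans `A` over `X`. -/
theorem Matroid.IsBasis'.subset_closure_union_of_contract {V : Type*} {M : Matroid V}
    {X A B : Set V} (h : (M.contract X).IsBasis' B A) (hX : X ⊆ M.E) (hA : A ⊆ M.E) :
    A ⊆ M.closure (X ∪ B) := by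
  intro a ha
  by_cases haX : a ∈ X
  · exact M.mem_closure_of_mem' (.inl haX) (hX haX)
  have hcl : a ∈ (M.contract X).closure B := by
    rw [h.closure_eq_closure]
    exact (M.contract X).mem_closure_of_mem' ha ⟨hA ha, haX⟩
  rw [M.contract_closure_eq, union_comm] at hcl
  exact hcl.1

/-- Additivity and monotonicity of the relative rank: if `X ⊆ X₁ ∩ X₂` and `A₁ ⊆ A ∩ X₁`, then
the rank of `A₁` over `X₂` plus the rank of `A` over `X₁` is at most the rank of `A` over `X`. -/
theorem mRelRk_add_le {V : Type*} {M : Matroid V} {X X₁ X₂ A A₁ : Set V} (hX : X ⊆ M.E)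
    (hA : A ⊆ M.E) (hfin : A.Finite) (hX₁ : X ⊆ X₁) (hX₂ : X ⊆ X₂) (hA₁ : A₁ ⊆ A)
    (hA₁X : A₁ ⊆ X₁) : mRelRk M X₂ A₁ + mRelRk M X₁ A ≤ mRelRk M X A := by
  obtain ⟨A₀, hA₀, hcard, hspan⟩ := exists_ncard_eq_mRelRk hX hA
  obtain ⟨B₁, hB₁⟩ := (M.contract X).exists_isBasis' A₁
  obtain ⟨B, hB, hB₁B⟩ := hB₁.indep.subset_isBasis'_of_subset (hB₁.subset.trans hA₁)
  have hBfin := hfin.subset hB.subset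
  have hle : B.ncard ≤ A₀.ncard := by
    have hsub : B ⊆ (M.contract X).closure A₀ := by
      rw [M.contract_closure_eq, union_comm]
      exact fun b hb ↦ ⟨hspan (hB.subset hb), (hB.indep.subset_ground hb).2⟩
    have henc : B.encard ≤ A₀.encard := by
      rw [← hB.indep.eRk_eq_encard]
      exact ((M.contract X).eRk_mono hsub).trans
        (((M.contract X).eRk_closure_eq A₀).le.trans ((M.contract X).eRk_le_encard A₀))
    rw [← hBfin.cast_ncard_eq, ← (hfin.subset hA₀).cast_ncard_eq] at henc
    exact_mod_cast henc
  have hle₁ : mRelRk M X₂ A₁ ≤ B₁.ncard := mRelRk_le_ncard hB₁.subset <|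
    (hB₁.subset_closure_union_of_contract hX (hA₁.trans hA)).trans
      (M.closure_subset_closure (union_subset_union_left _ hX₂))
  have hle₂ : mRelRk M X₁ A ≤ (B \ B₁).ncard := by
    refine mRelRk_le_ncard (sdiff_subset.trans hB.subset) <|
      (hB.subset_closure_union_of_contract hX hA).trans (M.closure_subset_closure ?_)
    rintro b (hb | hb)
    · exact .inl (hX₁ hb)
    · by_cases hb₁ : b ∈ B₁
      · exact .inl (hA₁X (hB₁.subset hb₁))
      · exact .inr ⟨hb, hb₁⟩
  have hsum := ncard_sdiff_add_ncard_of_subset hB₁B hBfin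
  omega

/-- If `X₁` and `X₂` are closed in `Z ⊆ M.E`, then so is `X₁ ∩ X₂`. -/
theorem bicolored_selfSuff_inter {V : Type*} (M : Matroid V) (P : Set V) (α : ℝ)
    (X₁ X₂ Z : Set V) (hZ : Z ⊆ M.E)
    (h1 : SelfSuffIn M P α X₁ Z) (h2 : SelfSuffIn M P α X₂ Z) :
    SelfSuffIn M P α (X₁ ∩ X₂) Z := by
  refine ⟨inter_subset_left.trans h1.1, fun A hAZ hfin ↦ ?_⟩
  have hδ₁ := h2.2 (A ∩ X₁) (inter_subset_left.trans hAZ) (hfin.inter_of_left X₁)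
  have hδ₂ := h1.2 A hAZ hfin
  have hrk : (mRelRk M X₂ (A ∩ X₁) : ℝ) + mRelRk M X₁ A ≤ mRelRk M (X₁ ∩ X₂) A := by
    exact_mod_cast mRelRk_add_le ((inter_subset_left.trans h1.1).trans hZ) (hAZ.trans hZ) hfin
      inter_subset_left inter_subset_right inter_subset_left inter_subset_right
  have hcard : (((A ∩ P) \ (X₁ ∩ X₂)).ncard : ℝ) =
      ((A ∩ X₁ ∩ P) \ X₂).ncard + ((A ∩ P) \ X₁).ncard := by
    have hunion : (A ∩ P) \ (X₁ ∩ X₂) = ((A ∩ X₁ ∩ P) \ X₂) ∪ ((A ∩ P) \ X₁) := by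
      ext x
      simp only [mem_sdiff, mem_inter_iff, mem_union]
      tauto
    rw [hunion, ncard_union_eq (disjoint_left.2 fun x hx hx' ↦ hx'.2 hx.1.1.2)
      (((hfin.inter_of_left X₁).inter_of_left P).sdiff) ((hfin.inter_of_left P).sdiff)]
    push_cast
    rfl
  unfold mDeltaRel at *
  rw [hcard, mul_add]
  linarith
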